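/- Let b be a prime, let n ≥ m ≥ 1 and s ≥ 1 be integers, let α ≥ 2 be an integer and γ = (γ_j)_{j≥1} positive reals, and let C_1,…,C_s be n×m matrices over F_b with associated digital net points x_0,…,x_{b^m−1} ∈ [0,1)^s and dual net D. Let B be the class of all functions f : [0,1)^s → ℂ admitting an absolutely convergent pointwise Walsh series representation f(x) = ∑_{k ∈ ℕ₀^s} f̂_k wal_k(x) with |f̂_k| ≤ r_α(γ,k) for all k ∈ ℕ₀^s, where f̂_k are the Walsh coefficients of f. Then the worst-case error of the quasi-Monte Carlo rule over B satisfies sup_{f ∈ B} |∫_{[0,1]^s} f(x) dx − (1/b^m) ∑_{h=0}^{b^m−1} f(x_h)| = ∑_{0 ≠ k ∈ D} r_α(γ,k), and the supremum is attained by the worst-case function ζ(x) = ∑_{k ∈ ℕ₀^s} r_α(γ,k) wal_k(x). -/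

import Mathlib

open scoped BigOperators
open scoped Classical

noncomputable section

/-- The `i`-th base-`b` digit (for `i ≥ 1`) of a real `x` (intended `x ∈ [0,1)`),
using the expansion that does not end in infinitely many digits `b-1`. -/
def xdigit (b : ℕ) (x : ℝ) (i : ℕ) : ℕ := (⌊x * (b : ℝ) ^ i⌋).toNat % b

/-- The `i`-th base-`b` digit of a natural number `k`. -/
def ndigit (b k i : ℕ) : ℕ := k / b ^ i % b

/-- The `k`-th Walsh function in base `b`:
`wal_k(x) = exp(2πi (ξ_1 κ_0 + ξ_2 κ_1 + ⋯)/b)`. -/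
def wal (b k : ℕ) (x : ℝ) : ℂ :=
  Complex.exp (2 * (Real.pi : ℂ) * Complex.I / (b : ℂ) *
    ∑ i ∈ Finset.range (k + 1), (ndigit b k i : ℂ) * (xdigit b x (i + 1) : ℂ))

/-- The set of positions of nonzero base-`b` digits of `k`. -/
def nzset (b k : ℕ) : Finset ℕ :=
  (Finset.range (k + 1)).filter fun i => ndigit b k i ≠ 0

/-- The (at most) `α` largest nonzero-digit positions of `k` in base `b`. -/
def topPos (b α k : ℕ) : Finset ℕ :=
  (nzset b k).filter fun a => ((nzset b k).filter fun y => a < y).card < α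

/-- `r_α(k) = b^{-∑_{i=1}^{min(#k,α)} (a_i + 1)}`, where `a_1 > a_2 > ⋯` are the positions of
the nonzero base-`b` digits of `k`; `r_α(0) = 1`. -/
def ralpha (b α k : ℕ) : ℝ := ((b : ℝ) ^ (∑ a ∈ topPos b α k, (a + 1)))⁻¹

/-- `r_α(γ, k) = ∏_{j : k_j ≠ 0} γ_j r_α(k_j)` (weights indexed from `0`). -/
def rvec (b α : ℕ) (γ : ℕ → ℝ) {s : ℕ} (k : Fin s → ℕ) : ℝ :=
  ∏ j, if k j = 0 then 1 else γ (j : ℕ) * ralpha b α (k j)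

/-- `ω_α(x) = ∑_{k=1}^∞ r_α(k) wal_k(x)`. -/
def omegaF (b α : ℕ) (x : ℝ) : ℂ :=
  ∑' k : ℕ, (ralpha b α (k + 1) : ℂ) * wal b (k + 1) x

open MeasureTheory Matrix

/-- The vector of the first `m` base-`b` digits of `h`, over `F_b`. -/
def digVec (b : ℕ) (m : ℕ) (h : ℕ) : Fin m → ZMod b := fun i => ((ndigit b h (i : ℕ) : ℕ) : ZMod b)

/-- The `j`-th coordinate of the `h`-th point of the digital net with generating matrix `C`:
`x_{h,j} = ∑_{i=1}^n y_{h,j,i} b^{-i}` where `y_{h,j} = C h⃗`. -/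
def netPoint (b n m : ℕ) (C : Matrix (Fin n) (Fin m) (ZMod b)) (h : ℕ) : ℝ :=
  ∑ i : Fin n, ((C.mulVec (digVec b m h)) i).val / (b : ℝ) ^ ((i : ℕ) + 1)

/-- Membership of `k ∈ ℕ₀^s` in the dual net: `C_1ᵀ k⃗_1 + ⋯ + C_sᵀ k⃗_s = 0` in `F_b^m`. -/
def inDualNet (b n m : ℕ) {s : ℕ} (C : Fin s → Matrix (Fin n) (Fin m) (ZMod b))
    (k : Fin s → ℕ) : Prop :=
  ∑ j, (C j)ᵀ.mulVec (digVec b n (k j)) = 0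

/-- The multivariate Walsh function `wal_k(x) = ∏_j wal_{k_j}(x_j)`. -/
def walv (b : ℕ) {s : ℕ} (k : Fin s → ℕ) (x : Fin s → ℝ) : ℂ := ∏ j, wal b (k j) (x j)

/-- The half-open unit cube `[0,1)^s`. -/
def cube (s : ℕ) : Set (Fin s → ℝ) := Set.univ.pi fun _ => Set.Ico (0 : ℝ) 1

/-- The Walsh coefficient `f̂_k = ∫_{[0,1]^s} f(x) conj(wal_k(x)) dx`. -/
def fhat (b : ℕ) {s : ℕ} (f : (Fin s → ℝ) → ℂ) (k : Fin s → ℕ) : ℂ :=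
  ∫ x in cube s, f x * (starRingEnd ℂ) (walv b k x)

/-- The unit ball `B` of the Walsh space: functions with an absolutely convergent pointwise
Walsh series whose Walsh coefficients satisfy `|f̂_k| ≤ r_α(γ,k)`. -/
def walshBall (b α : ℕ) (γ : ℕ → ℝ) (s : ℕ) : Set ((Fin s → ℝ) → ℂ) :=
  {f | (Summable fun k : Fin s → ℕ => ‖fhat b f k‖) ∧
    (∀ x ∈ cube s, f x = ∑' k : Fin s → ℕ, fhat b f k * walv b k x) ∧
    ∀ k : Fin s → ℕ, ‖fhat b f k‖ ≤ rvec b α γ k}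

/-- The absolute integration error of the QMC rule based on the digital net with generating
matrices `C`. -/
def qmcErr (b n m : ℕ) {s : ℕ} (C : Fin s → Matrix (Fin n) (Fin m) (ZMod b))
    (f : (Fin s → ℝ) → ℂ) : ℝ :=
  ‖(∫ x in cube s, f x) -
      (1 / (b : ℂ) ^ m) * ∑ h ∈ Finset.range (b ^ m), f fun j => netPoint b n m (C j) h‖

theorem ndigit_eq_zero {b k i : ℕ} (h : k < b ^ i) : ndigit b k i = 0 := by
  simp [ndigit, Nat.div_eq_of_lt h]

theorem ndigit_succ (b k i : ℕ) : ndigit b k (i + 1) = ndigit b (k / b) i := by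
  simp [ndigit, pow_succ', Nat.div_div_eq_div_mul]

theorem eq_of_ndigit_eq {b : ℕ} (N : ℕ) {k l : ℕ} (hk : k < b ^ N) (hl : l < b ^ N)
    (h : ∀ i < N, ndigit b k i = ndigit b l i) : k = l := by
  induction N generalizing k l with
  | zero => simp at hk hl; omega
  | succ N ih =>
    have hdiv : k / b = l / b := by
      refine ih ?_ ?_ fun i hi => ?_
      · exact Nat.div_lt_of_lt_mul (by rwa [pow_succ'] at hk)
      · exact Nat.div_lt_of_lt_mul (by rwa [pow_succ'] at hl)
      · simpa only [ndigit_succ] using h (i + 1) (by omega)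
    have hmod : k % b = l % b := by simpa [ndigit] using h 0 (by omega)
    rw [← Nat.div_add_mod k b, ← Nat.div_add_mod l b, hdiv, hmod]

theorem natCast_ndigit_inj {b k l i : ℕ} :
    ((ndigit b k i : ℕ) : ZMod b) = (ndigit b l i : ℕ) ↔ ndigit b k i = ndigit b l i := by
  rw [ZMod.natCast_eq_natCast_iff', ndigit, ndigit, Nat.mod_mod, Nat.mod_mod]

/-- The character `x ↦ exp(2πi (c_0 ξ_1 + ⋯ + c_{N-1} ξ_N) / b)`, where `ξ_i` is the `i`-th
base-`b` digit of the fractional part of `x`. -/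
def digitChar (b N : ℕ) [NeZero b] (c : ℕ → ZMod b) (x : ℝ) : ℂ :=
  ZMod.stdAddChar (∑ i ∈ Finset.range N, c i * ((⌊x * (b : ℝ) ^ (i + 1)⌋ : ℤ) : ZMod b))

theorem natCast_xdigit {b : ℕ} {x : ℝ} (hx : 0 ≤ x) (i : ℕ) :
    ((xdigit b x i : ℕ) : ZMod b) = ((⌊x * (b : ℝ) ^ i⌋ : ℤ) : ZMod b) := by
  have h : 0 ≤ ⌊x * (b : ℝ) ^ i⌋ := Int.floor_nonneg.2 (by positivity)
  rw [xdigit, ZMod.natCast_mod, ← Int.cast_natCast, Int.toNat_of_nonneg h]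

theorem lt_pow_self_succ {b : ℕ} (hb : 1 < b) (k : ℕ) : k < b ^ (k + 1) :=
  (Nat.lt_pow_self hb).trans (Nat.pow_lt_pow_right hb (by omega))

theorem wal_eq_digitChar {b : ℕ} [NeZero b] (hb : 1 < b) {k N : ℕ} (hk : k < b ^ N) {x : ℝ}
    (hx : 0 ≤ x) : wal b k x = digitChar b N (fun i => (ndigit b k i : ℕ)) x := by
  have hmono : ∀ M M', M ≤ M' → k < b ^ M →
      ∑ i ∈ Finset.range M, ((ndigit b k i : ℕ) : ZMod b) *
          ((⌊x * (b : ℝ) ^ (i + 1)⌋ : ℤ) : ZMod b) =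
        ∑ i ∈ Finset.range M', ((ndigit b k i : ℕ) : ZMod b) *
          ((⌊x * (b : ℝ) ^ (i + 1)⌋ : ℤ) : ZMod b) := by
    intro M M' hM hkM
    refine Finset.sum_subset (Finset.range_mono hM) fun i _ hi => ?_
    have : M ≤ i := by simpa using hi
    rw [ndigit_eq_zero (hkM.trans_le (Nat.pow_le_pow_right (by omega) this))]
    simp
  rw [digitChar, hmono N (max N (k + 1)) (le_max_left _ _) hk,
    ← hmono (k + 1) (max N (k + 1)) (le_max_right _ _) (lt_pow_self_succ hb k)]
  simp only [← natCast_xdigit hx]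
  have := ZMod.stdAddChar_coe (N := b)
    (∑ i ∈ Finset.range (k + 1), (ndigit b k i : ℤ) * (xdigit b x (i + 1) : ℤ))
  push_cast at this
  rw [this, wal]
  congr 1
  ring

theorem wal_zero (b : ℕ) (x : ℝ) : wal b 0 x = 1 := by
  simp [wal, ndigit]

theorem norm_wal (b k : ℕ) (x : ℝ) : ‖wal b k x‖ = 1 := by
  have : 2 * (Real.pi : ℂ) * Complex.I / (b : ℂ) *
      ∑ i ∈ Finset.range (k + 1), (ndigit b k i : ℂ) * (xdigit b x (i + 1) : ℂ) =
      ((2 * Real.pi / b *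
        ∑ i ∈ Finset.range (k + 1), (ndigit b k i : ℝ) * (xdigit b x (i + 1) : ℝ) : ℝ) : ℂ)
        * Complex.I := by
    push_cast
    ring
  rw [wal, this, Complex.norm_exp_ofReal_mul_I]

theorem measurable_xdigit (b i : ℕ) : Measurable fun x : ℝ => xdigit b x i := by
  have : Measurable fun z : ℤ => z.toNat % b := Measurable.of_discrete
  exact this.comp (Int.measurable_floor.comp (measurable_id.mul_const _))

theorem measurable_wal (b k : ℕ) : Measurable (wal b k) := by
  unfold wal
  refine Complex.measurable_exp.comp (Measurable.const_mul ?_ _)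
  refine Finset.measurable_sum _ fun i _ => Measurable.const_mul ?_ _
  have : Measurable fun z : ℕ => (z : ℂ) := Measurable.of_discrete
  exact this.comp (measurable_xdigit b (i + 1))

theorem digitChar_periodic {b : ℕ} [NeZero b] (N : ℕ) (c : ℕ → ZMod b) :
    Function.Periodic (digitChar b N c) 1 := by
  intro x
  unfold digitChar
  congr 1
  refine Finset.sum_congr rfl fun i _ => ?_
  have : (x + 1) * (b : ℝ) ^ (i + 1) = x * (b : ℝ) ^ (i + 1) + ((b ^ (i + 1) : ℤ) : ℝ) := by
    push_cast
    ring
  rw [this, Int.floor_add_intCast]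
  simp

theorem digitChar_add_inv_pow {b : ℕ} [NeZero b] {N a : ℕ} {c : ℕ → ZMod b} (ha : a < N)
    (hc : ∀ i < a, c i = 0) (x : ℝ) :
    digitChar b N c (x + ((b : ℝ) ^ (a + 1))⁻¹) =
      ZMod.stdAddChar (c a) * digitChar b N c x := by
  have hb : (b : ℝ) ≠ 0 := Nat.cast_ne_zero.2 (NeZero.ne b)
  have hterm : ∀ i, c i * ((⌊(x + ((b : ℝ) ^ (a + 1))⁻¹) * (b : ℝ) ^ (i + 1)⌋ : ℤ) : ZMod b) =
      (if i = a then c a else 0) + c i * ((⌊x * (b : ℝ) ^ (i + 1)⌋ : ℤ) : ZMod b) := by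
    intro i
    rcases lt_or_ge i a with hi | hi
    · simp [hc i hi, hi.ne]
    · obtain ⟨d, rfl⟩ := Nat.exists_eq_add_of_le hi
      have : (x + ((b : ℝ) ^ (a + 1))⁻¹) * (b : ℝ) ^ (a + d + 1) =
          x * (b : ℝ) ^ (a + d + 1) + ((b ^ d : ℤ) : ℝ) := by
        push_cast
        field_simp
        ring
      rw [this, Int.floor_add_intCast]
      rcases Nat.eq_zero_or_pos d with rfl | hd
      · simp; ring
      · simp [hd.ne']
  unfold digitChar
  simp only [hterm]
  rw [Finset.sum_add_distrib, AddChar.map_add_eq_mul]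
  simp [ha]

theorem integral_digitChar_eq_zero {b : ℕ} [NeZero b] {N : ℕ} {c : ℕ → ZMod b}
    (hc : ∃ i < N, c i ≠ 0) : ∫ x in (0 : ℝ)..1, digitChar b N c x = 0 := by
  have hca := (Nat.find_spec hc)
  set a := Nat.find hc
  have hmin : ∀ i < a, c i = 0 := fun i hi => by
    by_contra h
    exact Nat.find_min hc hi ⟨hi.trans hca.1, h⟩
  have h1 : ∫ x in (0 : ℝ)..1, digitChar b N c (x + ((b : ℝ) ^ (a + 1))⁻¹) =
      ∫ x in (0 : ℝ)..1, digitChar b N c x := by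
    rw [intervalIntegral.integral_comp_add_right]
    have := (digitChar_periodic N c).intervalIntegral_add_eq (((b : ℝ) ^ (a + 1))⁻¹) 0
    rw [zero_add] at this ⊢
    rwa [add_comm (1 : ℝ)]
  simp only [digitChar_add_inv_pow hca.1 hmin] at h1
  rw [intervalIntegral.integral_const_mul] at h1
  have h2 : (ZMod.stdAddChar (c a) : ℂ) ≠ 1 := by
    rw [← AddChar.map_zero_eq_one (ZMod.stdAddChar (N := b))]
    exact fun h => hca.2 (ZMod.injective_stdAddChar h)
  have h3 : ((ZMod.stdAddChar (c a) : ℂ) - 1) * ∫ x in (0 : ℝ)..1, digitChar b N c x = 0 := by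
    rw [sub_mul, h1, one_mul, sub_self]
  exact (mul_eq_zero.1 h3).resolve_left (sub_ne_zero.2 h2)

theorem integral_wal_mul_conj_wal {b : ℕ} [NeZero b] (hb : 1 < b) (k l : ℕ) :
    ∫ x in Set.Ico (0 : ℝ) 1, wal b k x * (starRingEnd ℂ) (wal b l x) =
      if k = l then 1 else 0 := by
  split_ifs with hkl
  · subst hkl
    simp [Complex.mul_conj, Complex.normSq_eq_norm_sq, norm_wal]
  · have hk : k < b ^ (max k l + 1) :=
      (lt_pow_self_succ hb k).trans_le (Nat.pow_le_pow_right (by omega) (by omega))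
    have hl : l < b ^ (max k l + 1) :=
      (lt_pow_self_succ hb l).trans_le (Nat.pow_le_pow_right (by omega) (by omega))
    have hprod : ∀ x ∈ Set.Ico (0 : ℝ) 1, wal b k x * (starRingEnd ℂ) (wal b l x) =
        digitChar b (max k l + 1)
          (fun i => ((ndigit b k i : ℕ) : ZMod b) - (ndigit b l i : ℕ)) x := by
      intro x hx
      rw [wal_eq_digitChar hb hk hx.1, wal_eq_digitChar hb hl hx.1, digitChar, digitChar,
        ← AddChar.map_neg_eq_conj, ← AddChar.map_add_eq_mul, digitChar, ← sub_eq_add_neg,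
        ← Finset.sum_sub_distrib]
      simp only [sub_mul]
    rw [setIntegral_congr_fun measurableSet_Ico hprod, integral_Ico_eq_integral_Ioc,
      ← intervalIntegral.integral_of_le zero_le_one]
    refine integral_digitChar_eq_zero ?_
    by_contra! h
    exact hkl (eq_of_ndigit_eq _ hk hl fun i hi =>
      natCast_ndigit_inj.1 (sub_eq_zero.1 (h i hi)))

theorem measurable_walv (b : ℕ) {s : ℕ} (k : Fin s → ℕ) : Measurable (walv b k) := by
  unfold walv
  exact Finset.measurable_prod _ fun j _ => (measurable_wal b (k j)).comp (measurable_pi_apply j)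

theorem norm_walv (b : ℕ) {s : ℕ} (k : Fin s → ℕ) (x : Fin s → ℝ) : ‖walv b k x‖ = 1 := by
  simp [walv, norm_prod, norm_wal]

theorem walv_zero (b : ℕ) {s : ℕ} (x : Fin s → ℝ) : walv b (0 : Fin s → ℕ) x = 1 := by
  simp [walv, wal_zero]

theorem integral_walv_mul_conj_walv {b : ℕ} [NeZero b] (hb : 1 < b) {s : ℕ} (k l : Fin s → ℕ) :
    ∫ x in cube s, walv b k x * (starRingEnd ℂ) (walv b l x) = if k = l then 1 else 0 := by
  simp only [walv, map_prod, ← Finset.prod_mul_distrib]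
  rw [cube, volume_pi, Measure.restrict_pi_pi,
    integral_fintype_prod_eq_prod
      (f := fun j y => wal b (k j) y * (starRingEnd ℂ) (wal b (l j) y))]
  simp only [integral_wal_mul_conj_wal hb]
  split_ifs with h
  · simp [h]
  · obtain ⟨j, hj⟩ := Function.ne_iff.1 h
    exact Finset.prod_eq_zero (Finset.mem_univ j) (if_neg hj)

theorem sum_range_div_pow_nonneg {b : ℕ} (n : ℕ) (y : ℕ → ℕ) :
    0 ≤ ∑ i ∈ Finset.range n, (y i : ℝ) / (b : ℝ) ^ (i + 1) :=
  Finset.sum_nonneg fun _ _ => by positivity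

theorem sum_range_succ_div_pow {b : ℕ} (n : ℕ) (y : ℕ → ℕ) :
    ∑ i ∈ Finset.range (n + 1), (y i : ℝ) / (b : ℝ) ^ (i + 1) =
      (y 0 + ∑ i ∈ Finset.range n, (y (i + 1) : ℝ) / (b : ℝ) ^ (i + 1)) / b := by
  rw [Finset.sum_range_succ', add_div, Finset.sum_div, add_comm]
  simp [pow_succ, div_div]

theorem sum_range_div_pow_lt_one {b : ℕ} (hb : 0 < b) (n : ℕ) {y : ℕ → ℕ} (hy : ∀ i, y i < b) :
    ∑ i ∈ Finset.range n, (y i : ℝ) / (b : ℝ) ^ (i + 1) < 1 := by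
  induction n generalizing y with
  | zero => simp
  | succ n ih =>
    have hb' : (0 : ℝ) < b := by exact_mod_cast hb
    have h0 : (y 0 : ℝ) + 1 ≤ b := by exact_mod_cast hy 0
    rw [sum_range_succ_div_pow, div_lt_one hb']
    linarith [ih fun i => hy (i + 1)]

theorem floor_sum_range_div_pow {b : ℕ} (hb : 0 < b) (n : ℕ) {y : ℕ → ℕ} (hy : ∀ i, y i < b)
    (i : ℕ) :
    ((⌊(∑ j ∈ Finset.range n, (y j : ℝ) / (b : ℝ) ^ (j + 1)) * (b : ℝ) ^ (i + 1)⌋ : ℤ) : ZMod b) =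
      if i < n then (y i : ZMod b) else 0 := by
  have hb' : (b : ℝ) ≠ 0 := by positivity
  induction n generalizing y i with
  | zero => simp
  | succ n ih =>
    rw [sum_range_succ_div_pow, pow_succ', ← mul_assoc, div_mul_cancel₀ _ hb', add_mul]
    cases i with
    | zero =>
      rw [pow_zero, mul_one, mul_one, ← Int.cast_natCast (R := ℝ), Int.floor_intCast_add,
        Int.floor_eq_zero_iff.2 ⟨sum_range_div_pow_nonneg n _,
          sum_range_div_pow_lt_one hb n fun i => hy (i + 1)⟩]
      simp
    | succ i =>
      have : (y 0 : ℝ) * (b : ℝ) ^ (i + 1) = ((y 0 * b ^ (i + 1) : ℤ) : ℝ) := by push_cast; ring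
      rw [this, Int.floor_intCast_add, Int.cast_add, ih fun i => hy (i + 1)]
      simp

theorem netPoint_eq_sum_range {b n m : ℕ} (C : Matrix (Fin n) (Fin m) (ZMod b)) (h : ℕ) :
    netPoint b n m C h = ∑ i ∈ Finset.range n,
      ((if hi : i < n then (C.mulVec (digVec b m h) ⟨i, hi⟩).val else 0 : ℕ) : ℝ) /
        (b : ℝ) ^ (i + 1) := by
  rw [Finset.sum_range, netPoint]
  simp

theorem netPoint_mem_Ico {b n m : ℕ} [NeZero b] (C : Matrix (Fin n) (Fin m) (ZMod b)) (h : ℕ) :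
    netPoint b n m C h ∈ Set.Ico (0 : ℝ) 1 := by
  rw [netPoint_eq_sum_range]
  refine ⟨sum_range_div_pow_nonneg n _, sum_range_div_pow_lt_one (NeZero.pos b) n fun i => ?_⟩
  split_ifs
  · exact ZMod.val_lt _
  · exact NeZero.pos b

theorem floor_netPoint_mul_pow {b n m : ℕ} [NeZero b] (C : Matrix (Fin n) (Fin m) (ZMod b))
    (h i : ℕ) :
    ((⌊netPoint b n m C h * (b : ℝ) ^ (i + 1)⌋ : ℤ) : ZMod b) =
      if hi : i < n then C.mulVec (digVec b m h) ⟨i, hi⟩ else 0 := by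
  rw [netPoint_eq_sum_range, floor_sum_range_div_pow (NeZero.pos b)]
  · split_ifs <;> simp
  · intro i
    split_ifs
    · exact ZMod.val_lt _
    · exact NeZero.pos b

theorem wal_netPoint {b n m : ℕ} [NeZero b] (hb : 1 < b) (C : Matrix (Fin n) (Fin m) (ZMod b))
    (k h : ℕ) :
    wal b k (netPoint b n m C h) =
      ZMod.stdAddChar (digVec b n k ⬝ᵥ C.mulVec (digVec b m h)) := by
  have hk : k < b ^ (k + 1 + n) :=
    (lt_pow_self_succ hb k).trans_le (Nat.pow_le_pow_right (by omega) (by omega))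
  rw [wal_eq_digitChar hb hk (netPoint_mem_Ico C h).1, digitChar]
  congr 1
  simp only [floor_netPoint_mul_pow]
  rw [← Finset.sum_subset (Finset.range_mono (show n ≤ k + 1 + n by omega)), Finset.sum_range]
  · simp [dotProduct, digVec]
  · intro i _ hi
    rw [dif_neg (by simpa using hi), mul_zero]

theorem walv_netPoint {b n m : ℕ} [NeZero b] (hb : 1 < b) {s : ℕ}
    (C : Fin s → Matrix (Fin n) (Fin m) (ZMod b)) (k : Fin s → ℕ) (h : ℕ) :
    walv b k (fun j => netPoint b n m (C j) h) =
      ZMod.stdAddChar ((∑ j, (C j)ᵀ.mulVec (digVec b n (k j))) ⬝ᵥ digVec b m h) := by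
  simp only [walv, wal_netPoint hb]
  rw [sum_dotProduct]
  refine Eq.trans ?_ (map_prod (ZMod.stdAddChar (N := b)).toMonoidHom
    (fun j => Multiplicative.ofAdd (((C j)ᵀ.mulVec (digVec b n (k j))) ⬝ᵥ digVec b m h)) _).symm
  refine Finset.prod_congr rfl fun j _ => ?_
  rw [dotProduct_mulVec, ← mulVec_transpose]
  rfl

theorem sum_range_digVec {b m : ℕ} [NeZero b] {M : Type*} [AddCommMonoid M]
    (F : (Fin m → ZMod b) → M) :
    ∑ h ∈ Finset.range (b ^ m), F (digVec b m h) = ∑ v, F v := by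
  rw [Finset.sum_range]
  refine Function.Bijective.sum_comp (e := fun h : Fin (b ^ m) => digVec b m h) ?_ F
  rw [Fintype.bijective_iff_injective_and_card]
  refine ⟨fun h h' hh => ?_, by simp [ZMod.card]⟩
  refine Fin.ext (eq_of_ndigit_eq m h.2 h'.2 fun i hi => ?_)
  exact natCast_ndigit_inj.1 (congrFun hh ⟨i, hi⟩)

theorem sum_stdAddChar_dotProduct {b m : ℕ} [NeZero b] (u : Fin m → ZMod b) :
    ∑ v : Fin m → ZMod b, (ZMod.stdAddChar (u ⬝ᵥ v) : ℂ) = if u = 0 then (b : ℂ) ^ m else 0 := by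
  let ψ : AddChar (Fin m → ZMod b) ℂ :=
    (ZMod.stdAddChar (N := b)).compAddMonoidHom
      { toFun := fun v => u ⬝ᵥ v, map_zero' := dotProduct_zero u, map_add' := dotProduct_add u }
  have hψ : ψ = 0 ↔ u = 0 := by
    constructor
    · intro h
      funext i
      have hi : (ZMod.stdAddChar (u ⬝ᵥ Pi.single i 1) : ℂ) = 1 :=
        DFunLike.congr_fun h (Pi.single i 1)
      rw [dotProduct_single_one, ← AddChar.map_zero_eq_one (ZMod.stdAddChar (N := b))] at hi
      exact ZMod.injective_stdAddChar hi
    · rintro rfl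
      ext v
      simp [ψ]
  have := AddChar.sum_eq_ite ψ
  simp only [hψ] at this
  refine this.trans ?_
  simp [ZMod.card]

theorem sum_walv_netPoint {b n m : ℕ} [NeZero b] (hb : 1 < b) {s : ℕ}
    (C : Fin s → Matrix (Fin n) (Fin m) (ZMod b)) (k : Fin s → ℕ) :
    ∑ h ∈ Finset.range (b ^ m), walv b k (fun j => netPoint b n m (C j) h) =
      if inDualNet b n m C k then (b : ℂ) ^ m else 0 := by
  simp only [walv_netPoint hb]
  rw [sum_range_digVec fun v => (ZMod.stdAddChar
    ((∑ j, (C j)ᵀ.mulVec (digVec b n (k j))) ⬝ᵥ v) : ℂ), sum_stdAddChar_dotProduct]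
  exact if_congr Iff.rfl rfl rfl

theorem inDualNet_zero {b n m s : ℕ} (C : Fin s → Matrix (Fin n) (Fin m) (ZMod b)) :
    inDualNet b n m C 0 := by
  have : digVec b n 0 = 0 := by
    ext i
    simp [digVec, ndigit]
  simp [inDualNet, this]

theorem integral_sub_net_average {b n m : ℕ} [NeZero b] (hb : 1 < b) {s : ℕ}
    (C : Fin s → Matrix (Fin n) (Fin m) (ZMod b)) {f : (Fin s → ℝ) → ℂ}
    (hsum : Summable fun k : Fin s → ℕ => ‖fhat b f k‖)
    (hf : ∀ x ∈ cube s, f x = ∑' k : Fin s → ℕ, fhat b f k * walv b k x) :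
    (∫ x in cube s, f x) -
        (1 / (b : ℂ) ^ m) * ∑ h ∈ Finset.range (b ^ m), f (fun j => netPoint b n m (C j) h) =
      -∑' k : Fin s → ℕ, if k ≠ 0 ∧ inDualNet b n m C k then fhat b f k else 0 := by
  have hb0 : (b : ℂ) ^ m ≠ 0 := pow_ne_zero _ (Nat.cast_ne_zero.2 (NeZero.ne b))
  have hcoef0 : ∫ x in cube s, f x = fhat b f 0 := by simp [fhat, walv_zero]
  have hsummable : ∀ x, Summable fun k : Fin s → ℕ => fhat b f k * walv b k x := fun x =>
    Summable.of_norm (by simpa [norm_walv] using hsum)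
  have hpt : ∀ h, f (fun j => netPoint b n m (C j) h) =
      ∑' k : Fin s → ℕ, fhat b f k * walv b k (fun j => netPoint b n m (C j) h) := fun h =>
    hf _ fun j _ => netPoint_mem_Ico (C j) h
  have havg : (1 / (b : ℂ) ^ m) *
      ∑ h ∈ Finset.range (b ^ m), f (fun j => netPoint b n m (C j) h) =
        ∑' k : Fin s → ℕ, if inDualNet b n m C k then fhat b f k else 0 := by
    simp only [hpt]
    rw [← Summable.tsum_finsetSum fun h _ => hsummable _, ← tsum_mul_left]
    refine tsum_congr fun k => ?_
    rw [← Finset.mul_sum, sum_walv_netPoint hb]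
    split_ifs
    · field_simp
    · simp
  have hD : Summable fun k : Fin s → ℕ => if inDualNet b n m C k then fhat b f k else 0 := by
    refine Summable.of_norm_bounded hsum fun k => ?_
    split_ifs <;> simp
  rw [havg, hcoef0, hD.tsum_eq_add_tsum_ite 0, if_pos (inDualNet_zero C), sub_add_cancel_left]
  congr 1
  refine tsum_congr fun k => ?_
  by_cases hk : k = 0 <;> simp [hk]

theorem mem_nzset {b : ℕ} (hb : 1 < b) {k i : ℕ} : i ∈ nzset b k ↔ ndigit b k i ≠ 0 := by
  rw [nzset, Finset.mem_filter, Finset.mem_range, and_iff_right_iff_imp]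
  intro h
  by_contra hi
  exact h (ndigit_eq_zero ((Nat.lt_pow_self hb).trans_le
    (Nat.pow_le_pow_right (by omega) (by omega))))

theorem ndigit_mul_pow_add_of_lt {b N κ j i : ℕ} (hb : 0 < b) (hi : i < N) :
    ndigit b (b ^ N * κ + j) i = ndigit b j i := by
  obtain ⟨d, rfl⟩ := Nat.exists_eq_add_of_lt hi
  have : b ^ (i + d + 1) * κ + j = j + b ^ i * (b * (b ^ d * κ)) := by ring
  rw [ndigit, ndigit, this, Nat.add_mul_div_left _ _ (by positivity), Nat.add_mul_mod_self_left]

theorem ndigit_mul_pow_add_self {b N κ j : ℕ} (hκ : κ < b) (hj : j < b ^ N) :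
    ndigit b (b ^ N * κ + j) N = κ := by
  rw [ndigit, Nat.mul_add_div (by omega), Nat.div_eq_of_lt hj, add_zero, Nat.mod_eq_of_lt hκ]

theorem mul_pow_add_lt {b N κ j : ℕ} (hκ : κ < b) (hj : j < b ^ N) :
    b ^ N * κ + j < b ^ (N + 1) := by
  calc b ^ N * κ + j < b ^ N * κ + b ^ N := by omega
    _ = b ^ N * (κ + 1) := by ring
    _ ≤ b ^ (N + 1) := by rw [pow_succ]; exact Nat.mul_le_mul_left _ hκ

theorem ndigit_log_ne_zero {b j : ℕ} (hb : 1 < b) (hj : j ≠ 0) :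
    ndigit b j (Nat.log b j) ≠ 0 := by
  have hpos : 0 < b ^ Nat.log b j := by positivity
  have h1 : 0 < j / b ^ Nat.log b j := Nat.div_pos (Nat.pow_log_le_self b hj) hpos
  have h2 : j / b ^ Nat.log b j < b :=
    Nat.div_lt_of_lt_mul (by simpa [pow_succ] using Nat.lt_pow_succ_log_self hb j)
  rw [ndigit, Nat.mod_eq_of_lt h2]
  omega

/-- `b^{-(a+1)}`, where `a` is the leading digit position of `k`, and `1` for `k = 0`. -/
def leadInv (b k : ℕ) : ℝ := if k = 0 then 1 else ((b : ℝ) ^ (Nat.log b k + 1))⁻¹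

theorem ralpha_nonneg (b α k : ℕ) : 0 ≤ ralpha b α k := by
  unfold ralpha
  positivity

theorem ralpha_zero (b α : ℕ) : ralpha b α 0 = 1 := by
  simp [ralpha, topPos, nzset, ndigit]

theorem ralpha_le_of_subset {b α k : ℕ} (hb : 1 < b) {t : Finset ℕ} (ht : t ⊆ topPos b α k) :
    ralpha b α k ≤ ((b : ℝ) ^ (∑ a ∈ t, (a + 1)))⁻¹ := by
  have hb' : (1 : ℝ) ≤ b := by exact_mod_cast hb.le
  refine inv_anti₀ (by positivity) (pow_le_pow_right₀ hb' ?_)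
  exact Finset.sum_le_sum_of_subset ht

theorem ralpha_mul_pow_add_le {b α N κ j : ℕ} (hb : 1 < b) (hα : 2 ≤ α) (hκ0 : κ ≠ 0)
    (hκ : κ < b) (hj : j < b ^ N) :
    ralpha b α (b ^ N * κ + j) ≤ ((b : ℝ) ^ (N + 1))⁻¹ * leadInv b j := by
  set k := b ^ N * κ + j with hk
  have hkN : ndigit b k N ≠ 0 := by rwa [hk, ndigit_mul_pow_add_self hκ hj]
  have hle : ∀ i, ndigit b k i ≠ 0 → i ≤ N := by
    intro i hi
    by_contra h
    exact hi (ndigit_eq_zero ((mul_pow_add_lt hκ hj).trans_le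
      (Nat.pow_le_pow_right (by omega) (by omega))))
  have hN : N ∈ topPos b α k := by
    rw [topPos, Finset.mem_filter, mem_nzset hb]
    refine ⟨hkN, ?_⟩
    rw [Finset.filter_false_of_mem]
    · simp; omega
    · intro y hy
      have := hle y ((mem_nzset hb).1 hy)
      omega
  unfold leadInv
  split_ifs with hj0
  · simpa using ralpha_le_of_subset hb (Finset.singleton_subset_iff.2 hN)
  · have hLN : Nat.log b j < N := Nat.log_lt_of_lt_pow hj0 hj
    have hL : Nat.log b j ∈ topPos b α k := by
      rw [topPos, Finset.mem_filter, mem_nzset hb, hk, ndigit_mul_pow_add_of_lt (by omega) hLN]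
      refine ⟨ndigit_log_ne_zero hb hj0, ?_⟩
      refine lt_of_le_of_lt (Finset.card_le_card (t := {N}) fun y hy => ?_) (by simp; omega)
      rw [Finset.mem_filter, mem_nzset hb] at hy
      rw [Finset.mem_singleton]
      refine (hle y hy.1).eq_of_not_lt fun hyN => hy.1 ?_
      rw [ndigit_mul_pow_add_of_lt (by omega) hyN]
      exact ndigit_eq_zero ((Nat.lt_pow_succ_log_self hb j).trans_le
        (Nat.pow_le_pow_right (by omega) hy.2))
    have := ralpha_le_of_subset hb (t := {N, Nat.log b j})
      (Finset.insert_subset hN (Finset.singleton_subset_iff.2 hL))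
    rwa [Finset.sum_pair hLN.ne', pow_add, mul_inv] at this

theorem sum_range_mul_eq {M : Type*} [AddCommMonoid M] (f : ℕ → M) (n c : ℕ) :
    ∑ k ∈ Finset.range (n * c), f k =
      ∑ κ ∈ Finset.range c, ∑ j ∈ Finset.range n, f (n * κ + j) := by
  induction c with
  | zero => simp
  | succ c ih => rw [Nat.mul_succ, Finset.sum_range_add, ih, Finset.sum_range_succ]

theorem sum_range_pow_succ_le {b : ℕ} (hb : 1 < b) (f : ℕ → ℝ) (N : ℕ) {B : ℝ}
    (hB : ∀ κ, κ ≠ 0 → κ < b → ∑ j ∈ Finset.range (b ^ N), f (b ^ N * κ + j) ≤ B / b)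
    (hB0 : 0 ≤ B) :
    ∑ k ∈ Finset.range (b ^ (N + 1)), f k ≤ ∑ k ∈ Finset.range (b ^ N), f k + B := by
  obtain ⟨c, rfl⟩ := Nat.exists_eq_add_of_lt hb
  rw [pow_succ, sum_range_mul_eq, Finset.sum_range_succ', add_comm]
  simp only [mul_zero, zero_add]
  gcongr
  calc _ ≤ ∑ κ ∈ Finset.range (1 + c), B / ((1 + c + 1 : ℕ) : ℝ) :=
        Finset.sum_le_sum fun κ hκ => hB (κ + 1) (by omega) (by simpa using hκ)
    _ = (1 + c : ℕ) / ((1 + c + 1 : ℕ) : ℝ) * B := by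
        rw [Finset.sum_const, Finset.card_range, nsmul_eq_mul]; ring
    _ ≤ 1 * B := by
        gcongr
        rw [div_le_one (by positivity)]
        exact_mod_cast Nat.le_succ _
    _ = B := one_mul B

theorem sum_leadInv_le {b : ℕ} (hb : 1 < b) (N : ℕ) :
    ∑ k ∈ Finset.range (b ^ N), leadInv b k ≤ N + 1 := by
  have hb' : (b : ℝ) ≠ 0 := by positivity
  induction N with
  | zero => simp [leadInv]
  | succ N ih =>
    have := sum_range_pow_succ_le hb (leadInv b) N (B := 1) (fun κ h0 hκ => ?_) zero_le_one
    · push_cast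
      linarith
    · refine (Finset.sum_le_card_nsmul _ _ ((b : ℝ) ^ (N + 1))⁻¹ fun j hj => ?_).trans ?_
      · have hge : b ^ N ≤ b ^ N * κ + j :=
          (Nat.le_mul_of_pos_right _ (Nat.pos_of_ne_zero h0)).trans (Nat.le_add_right _ _)
        have hlog : Nat.log b (b ^ N * κ + j) = N :=
          (Nat.log_eq_iff (Or.inr ⟨hb, by positivity⟩)).2
            ⟨hge, mul_pow_add_lt hκ (Finset.mem_range.1 hj)⟩
        have hne : b ^ N * κ + j ≠ 0 := (lt_of_lt_of_le (by positivity) hge).ne'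
        rw [leadInv, if_neg hne, hlog]
      · rw [Finset.card_range, nsmul_eq_mul]
        push_cast
        rw [pow_succ]
        field_simp
        exact le_rfl

theorem summable_succ_mul_inv_pow {b : ℕ} (hb : 1 < b) :
    Summable fun N : ℕ => ((N : ℝ) + 1) * ((b : ℝ)⁻¹) ^ N := by
  have hr : ‖(b : ℝ)⁻¹‖ < 1 := by
    rw [norm_inv, Real.norm_natCast]
    exact inv_lt_one_of_one_lt₀ (by exact_mod_cast hb)
  have h := (summable_pow_mul_geometric_of_norm_lt_one 1 hr).add
    (summable_geometric_of_norm_lt_one hr)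
  refine h.congr fun N => ?_
  ring

theorem sum_ralpha_le {b α : ℕ} (hb : 1 < b) (hα : 2 ≤ α) (N : ℕ) :
    ∑ k ∈ Finset.range (b ^ N), ralpha b α k ≤
      1 + ∑ i ∈ Finset.range N, ((i : ℝ) + 1) * ((b : ℝ)⁻¹) ^ i := by
  have hb' : (b : ℝ) ≠ 0 := by positivity
  induction N with
  | zero => simp [ralpha_zero]
  | succ N ih =>
    have := sum_range_pow_succ_le hb (ralpha b α) N (B := ((N : ℝ) + 1) * ((b : ℝ)⁻¹) ^ N)
      (fun κ h0 hκ => ?_) (by positivity)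
    · rw [Finset.sum_range_succ]
      linarith
    · calc _ ≤ ∑ j ∈ Finset.range (b ^ N), ((b : ℝ) ^ (N + 1))⁻¹ * leadInv b j :=
            Finset.sum_le_sum fun j hj =>
              ralpha_mul_pow_add_le hb hα h0 hκ (Finset.mem_range.1 hj)
        _ ≤ ((b : ℝ) ^ (N + 1))⁻¹ * (N + 1) := by
            rw [← Finset.mul_sum]
            gcongr
            exact sum_leadInv_le hb N
        _ = ((N : ℝ) + 1) * ((b : ℝ)⁻¹) ^ N / b := by
            rw [pow_succ, inv_pow]
            field_simp

theorem summable_ralpha {b α : ℕ} (hb : 1 < b) (hα : 2 ≤ α) : Summable (ralpha b α) := by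
  refine summable_of_sum_range_le (ralpha_nonneg b α)
    (c := 1 + ∑' i : ℕ, ((i : ℝ) + 1) * ((b : ℝ)⁻¹) ^ i) fun N => ?_
  calc _ ≤ ∑ k ∈ Finset.range (b ^ N), ralpha b α k :=
        Finset.sum_le_sum_of_subset_of_nonneg (Finset.range_mono (Nat.lt_pow_self hb).le)
          fun _ _ _ => ralpha_nonneg b α _
    _ ≤ _ := (sum_ralpha_le hb hα N).trans <| by
        gcongr
        exact (summable_succ_mul_inv_pow hb).sum_le_tsum _ fun _ _ => by positivity

theorem summable_pi_prod {s : ℕ} {g : Fin s → ℕ → ℝ} (h0 : ∀ j k, 0 ≤ g j k)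
    (hg : ∀ j, Summable (g j)) : Summable fun k : Fin s → ℕ => ∏ j, g j (k j) := by
  refine summable_of_sum_le (fun k => Finset.prod_nonneg fun j _ => h0 j (k j))
    (c := ∏ j, ∑' k, g j k) fun u => ?_
  calc _ ≤ ∑ k ∈ Fintype.piFinset fun j => u.image fun k => k j, ∏ j, g j (k j) := by
        refine Finset.sum_le_sum_of_subset_of_nonneg (fun k hk => ?_)
          fun k _ _ => Finset.prod_nonneg fun j _ => h0 j (k j)
        exact Fintype.mem_piFinset.2 fun j => Finset.mem_image_of_mem _ hk
    _ = ∏ j, ∑ k ∈ u.image fun k => k j, g j k := by rw [Finset.prod_univ_sum]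
    _ ≤ _ := Finset.prod_le_prod (fun j _ => Finset.sum_nonneg fun k _ => h0 j k)
        fun j _ => (hg j).sum_le_tsum _ fun k _ => h0 j k

theorem rvec_nonneg {b α s : ℕ} {γ : ℕ → ℝ} (hγ : ∀ j, 0 < γ j) (k : Fin s → ℕ) :
    0 ≤ rvec b α γ k := by
  refine Finset.prod_nonneg fun j _ => ?_
  split_ifs
  · exact zero_le_one
  · exact mul_nonneg (hγ j).le (ralpha_nonneg b α _)

theorem summable_rvec {b α s : ℕ} (hb : 1 < b) (hα : 2 ≤ α) {γ : ℕ → ℝ} (hγ : ∀ j, 0 < γ j) :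
    Summable fun k : Fin s → ℕ => rvec b α γ k := by
  let g : Fin s → ℕ → ℝ := fun j k => if k = 0 then 1 else γ (j : ℕ) * ralpha b α k
  have hg : ∀ j k, 0 ≤ g j k ∧ g j k ≤ (1 + γ (j : ℕ)) * ralpha b α k := by
    intro j k
    have h1 := ralpha_nonneg b α k
    have h2 := mul_nonneg (hγ j).le h1
    simp only [g]
    split_ifs with hk
    · rw [hk, ralpha_zero]
      constructor <;> linarith [hγ j]
    · constructor <;> linarith
  exact summable_pi_prod (g := g) (fun j k => (hg j k).1) fun j =>
    Summable.of_nonneg_of_le (fun k => (hg j k).1) (fun k => (hg j k).2)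
      ((summable_ralpha hb hα).mul_left _)

theorem fhat_tsum_mul_walv {b s : ℕ} [NeZero b] (hb : 1 < b) {c : (Fin s → ℕ) → ℂ}
    (hc : Summable fun k => ‖c k‖) (k : Fin s → ℕ) :
    fhat b (fun x => ∑' l : Fin s → ℕ, c l * walv b l x) k = c k := by
  have hvol : volume (cube s) = 1 := by simp [cube, volume_pi_pi]
  have hmeas : ∀ l : Fin s → ℕ,
      Measurable fun x => c l * walv b l x * (starRingEnd ℂ) (walv b k x) := fun l =>
    ((measurable_walv b l).const_mul _).mul (Complex.continuous_conj.measurable.comp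
      (measurable_walv b k))
  have hnorm : ∀ (l : Fin s → ℕ) x,
      ‖c l * walv b l x * (starRingEnd ℂ) (walv b k x)‖ = ‖c l‖ := by
    intro l x
    simp [norm_walv]
  have hfin : IsFiniteMeasure (volume.restrict (cube s)) :=
    isFiniteMeasure_restrict.2 (by simp [hvol])
  have h := hasSum_integral_of_summable_integral_norm (μ := volume.restrict (cube s))
    (F := fun (l : Fin s → ℕ) x => c l * walv b l x * (starRingEnd ℂ) (walv b k x))
    (fun l => (integrable_const (c l)).mono (hmeas l).aestronglyMeasurable
      (Filter.Eventually.of_forall fun x => (hnorm l x).le))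
    (by simpa only [hnorm, integral_const, measureReal_def,
      Measure.restrict_apply_univ, hvol, ENNReal.toReal_one, one_smul] using hc)
  simp only [mul_assoc, integral_const_mul, integral_walv_mul_conj_walv hb] at h
  simp only [fhat, ← tsum_mul_right, mul_assoc]
  rw [← h.tsum_eq]
  simp

/-- The worst-case error of a digital net over the unit ball of the Walsh space equals
`∑_{0 ≠ k ∈ D} r_α(γ,k)`, and the supremum is attained by the worst-case function
`ζ(x) = ∑_k r_α(γ,k) wal_k(x)`. -/
theorem stmt16 (b n m s α : ℕ) [Fact (Nat.Prime b)] (hm : 1 ≤ m) (hmn : m ≤ n) (hs : 1 ≤ s)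
    (hα : 2 ≤ α) (γ : ℕ → ℝ) (hγ : ∀ j, 0 < γ j)
    (C : Fin s → Matrix (Fin n) (Fin m) (ZMod b)) :
    (∀ f ∈ walshBall b α γ s, qmcErr b n m C f ≤
        ∑' k : Fin s → ℕ, if k ≠ 0 ∧ inDualNet b n m C k then rvec b α γ k else 0) ∧
    (fun x => ∑' k : Fin s → ℕ, ((rvec b α γ k : ℝ) : ℂ) * walv b k x) ∈ walshBall b α γ s ∧
    qmcErr b n m C (fun x => ∑' k : Fin s → ℕ, ((rvec b α γ k : ℝ) : ℂ) * walv b k x) =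
      ∑' k : Fin s → ℕ, if k ≠ 0 ∧ inDualNet b n m C k then rvec b α γ k else 0 := by
  have hb : 1 < b := (Fact.out : Nat.Prime b).one_lt
  have hsum : Summable fun k : Fin s → ℕ => rvec b α γ k := summable_rvec hb hα hγ
  have hnorm : ∀ k : Fin s → ℕ, ‖((rvec b α γ k : ℝ) : ℂ)‖ = rvec b α γ k := fun k => by
    rw [Complex.norm_real, Real.norm_of_nonneg (rvec_nonneg hγ k)]
  have hcoef : ∀ k : Fin s → ℕ,
      fhat b (fun x => ∑' l : Fin s → ℕ, ((rvec b α γ l : ℝ) : ℂ) * walv b l x) k =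
        ((rvec b α γ k : ℝ) : ℂ) :=
    fhat_tsum_mul_walv hb (by simpa only [hnorm] using hsum)
  have hball : (fun x => ∑' k : Fin s → ℕ, ((rvec b α γ k : ℝ) : ℂ) * walv b k x) ∈
      walshBall b α γ s := by
    refine ⟨?_, fun x _ => ?_, fun k => ?_⟩
    · simpa only [hcoef, hnorm] using hsum
    · simp only [hcoef]
    · rw [hcoef, hnorm]
  refine ⟨fun f hf => ?_, hball, ?_⟩
  · have hD : Summable fun k : Fin s → ℕ =>
        if k ≠ 0 ∧ inDualNet b n m C k then rvec b α γ k else 0 := by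
      refine Summable.of_nonneg_of_le (fun k => ?_) (fun k => ?_) hsum
      · split_ifs <;> simp [rvec_nonneg hγ]
      · split_ifs <;> simp [rvec_nonneg hγ]
    rw [qmcErr, integral_sub_net_average hb C hf.1 hf.2.1, norm_neg]
    refine tsum_of_norm_bounded hD.hasSum fun k => ?_
    split_ifs
    · exact hf.2.2 k
    · simp
  · rw [qmcErr, integral_sub_net_average hb C hball.1 hball.2.1, norm_neg]
    simp only [hcoef]
    have hcast : ∀ k : Fin s → ℕ,
        (if k ≠ 0 ∧ inDualNet b n m C k then ((rvec b α γ k : ℝ) : ℂ) else 0) =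
          ((if k ≠ 0 ∧ inDualNet b n m C k then rvec b α γ k else 0 : ℝ) : ℂ) := fun k => by
      split_ifs <;> simp
    simp only [hcast]
    rw [← Complex.ofReal_tsum, Complex.norm_real, Real.norm_of_nonneg]
    refine tsum_nonneg fun k => ?_
    split_ifs <;> simp [rvec_nonneg hγ]
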